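/- For 1 < p < q ≤ ∞, the weak Lebesgue space L^{p,∞}(ℝ^N) embeds continuously into the homogeneous Besov space Ḃ^{N/q − N/p}_{q,∞}(ℝ^N); that is, there exists C > 0 such that for every u ∈ L^{p,∞}(ℝ^N) and every q-block, sup_{j∈ℤ} 2^{j(N/q − N/p)}‖Δ̇_j u‖_{L^q} ≤ C‖u‖_{L^{p,∞}}. -/

import Mathlib

open MeasureTheory Real Set Filter
open scoped ENNReal NNReal FourierTransform BigOperators

noncomputable section

namespace Paper

/-- The Euclidean space `ℝ^N`. -/
abbrev Spc (N : ℕ) : Type := EuclideanSpace ℝ (Fin N)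

variable {N : ℕ} {F : Type*} [NormedAddCommGroup F] [NormedSpace ℝ F]

/-- The `i`-th canonical basis vector of `ℝ^N`. -/
def e (N : ℕ) (i : Fin N) : Spc N := EuclideanSpace.single i 1

/-- The index of the `N`-th coordinate. -/
def lastIdx (N : ℕ) (hN : 0 < N) : Fin N := ⟨N - 1, by omega⟩

/-- Smooth compactly supported test function on space-time. -/
def Test (ψ : ℝ × Spc N → F) : Prop := ContDiff ℝ (⊤ : ℕ∞) ψ ∧ HasCompactSupport ψ

/-- Smooth compactly supported test function on space. -/
def TestS (ψ : Spc N → F) : Prop := ContDiff ℝ (⊤ : ℕ∞) ψ ∧ HasCompactSupport ψ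

/-- A space-time function vanishing for times `≥ T`. -/
def VanishAfter (T : ℝ) (ψ : ℝ × Spc N → F) : Prop := ∀ p : ℝ × Spc N, T ≤ p.1 → ψ p = 0

/-- Time derivative. -/
def dt (ψ : ℝ × Spc N → F) (p : ℝ × Spc N) : F := fderiv ℝ ψ p (1, 0)

/-- Spatial derivative in direction `i`. -/
def dx (i : Fin N) (ψ : ℝ × Spc N → F) (p : ℝ × Spc N) : F := fderiv ℝ ψ p (0, e N i)

/-- Spatial Laplacian. -/
def lap (ψ : ℝ × Spc N → F) (p : ℝ × Spc N) : F := ∑ i, dx i (fun q => dx i ψ q) p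

/-- A vector field is divergence free in the distributional sense. -/
def WeakDivFree (u : Spc N → Spc N) : Prop :=
  ∀ ψ : Spc N → ℝ, TestS ψ → ∫ x, ∑ i, u x i * fderiv ℝ ψ x (e N i) = 0

/-- Pointwise divergence. -/
def divg (u : Spc N → Spc N) (x : Spc N) : ℝ := ∑ i, fderiv ℝ (fun y => u y i) x (e N i)

/-- Matrix-valued functions on `ℝ^N`. -/
abbrev Mat (N : ℕ) : Type := EuclideanSpace ℝ (Fin N × Fin N)

/-- `G` is the (weak, distributional) Jacobian matrix of `u`. -/
def IsWeakJacobian (u : Spc N → Spc N) (G : Spc N → Mat N) : Prop :=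
  ∀ i j : Fin N, ∀ ψ : Spc N → ℝ, TestS ψ →
    ∫ x, u x j * fderiv ℝ ψ x (e N i) = - ∫ x, G x (i, j) * ψ x

/-- Weak `L^p` quasi-norm: `sup_{λ>0} λ |{|f|>λ}|^{1/p}`. -/
def wLp (p : ℝ) (f : Spc N → F) : ℝ≥0∞ :=
  ⨆ lam ∈ Ioi (0:ℝ), ENNReal.ofReal lam * volume {x | lam < ‖f x‖} ^ (1 / p)

/-- Real part of the inverse Fourier transform of a real function. -/
def invKer (g : Spc N → ℝ) : Spc N → ℝ :=
  fun x => (𝓕⁻ (fun ξ : Spc N => (g ξ : ℂ)) x).re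

/-- Homogeneous Littlewood–Paley block `Δ̇_q`, i.e. convolution with the kernel of
`ξ ↦ φ(2^{-q} ξ)`. -/
def hBlock (φ : Spc N → ℝ) (q : ℤ) (u : Spc N → F) : Spc N → F :=
  fun x => ∫ y, invKer (fun ξ => φ ((2:ℝ) ^ (-q) • ξ)) (x - y) • u y

/-- Low-frequency cut-off `Ṡ₀`, i.e. convolution with the kernel of `χ`. -/
def lowBlock (χ : Spc N → ℝ) (u : Spc N → F) : Spc N → F :=
  fun x => ∫ y, invKer χ (x - y) • u y

/-- Non-homogeneous Littlewood–Paley block. -/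
def nBlock (χ φ : Spc N → ℝ) (q : ℤ) (u : Spc N → F) : Spc N → F :=
  if q = -1 then lowBlock χ u else if 0 ≤ q then hBlock φ q u else 0

/-- The data of a Littlewood–Paley dyadic partition of unity:  `χ` is smooth, radial,
nonincreasing, equal to `1` on the ball of radius `3/4` and supported in the ball of radius
`4/3`, and `φ(ξ) = χ(ξ/2) - χ(ξ)` is supported in an annulus. -/
structure IsLPData (N : ℕ) (χ φ : Spc N → ℝ) : Prop where
  smooth : ContDiff ℝ (⊤ : ℕ∞) χ
  suppPt : ∀ ξ : Spc N, (4:ℝ)/3 ≤ ‖ξ‖ → χ ξ = 0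
  onePt : ∀ ξ : Spc N, ‖ξ‖ ≤ 3/4 → χ ξ = 1
  radial : ∀ ξ η : Spc N, ‖ξ‖ = ‖η‖ → χ ξ = χ η
  mono : ∀ ξ η : Spc N, ‖ξ‖ ≤ ‖η‖ → χ η ≤ χ ξ
  phiDef : ∀ ξ : Spc N, φ ξ = χ ((2:ℝ)⁻¹ • ξ) - χ ξ

/-- The `ℓ^r(ℤ)` norm of a sequence of extended nonnegative reals. -/
def lr (r : ℝ≥0∞) (a : ℤ → ℝ≥0∞) : ℝ≥0∞ :=
  if r = ∞ then ⨆ q, a q else (∑' q, a q ^ r.toReal) ^ (1 / r.toReal)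

/-- Homogeneous Besov (quasi-)norm `‖u‖_{Ḃ^s_{p,r}}`. -/
def besov (φ : Spc N → ℝ) (s : ℝ) (p r : ℝ≥0∞) (u : Spc N → F) : ℝ≥0∞ :=
  lr r fun q => (2 : ℝ≥0∞) ^ ((q : ℝ) * s) * eLpNorm (hBlock φ q u) p volume

/-- `L^ρ` norm in time on `(0,T)` of an `ℝ≥0∞`-valued function. -/
def tLp (ρ : ℝ≥0∞) (T : ℝ) (g : ℝ → ℝ≥0∞) : ℝ≥0∞ :=
  if ρ = ∞ then ⨆ t ∈ Icc (0:ℝ) T, g t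
  else (∫⁻ t in Ioc (0:ℝ) T, g t ^ ρ.toReal) ^ (1 / ρ.toReal)

/-- Chemin–Lerner norm `‖u‖_{L̃^ρ_T(Ḃ^s_{p,r})}`. -/
def clNorm (φ : Spc N → ℝ) (s : ℝ) (p r ρ : ℝ≥0∞) (T : ℝ) (u : ℝ → Spc N → F) : ℝ≥0∞ :=
  lr r fun q =>
    (2 : ℝ≥0∞) ^ ((q : ℝ) * s) * tLp ρ T fun t => eLpNorm (hBlock φ q (u t)) p volume

/-- The Gaussian heat kernel on `ℝ^N`. -/
def heatKer (N : ℕ) (τ : ℝ) (x : Spc N) : ℝ :=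
  (4 * π * τ) ^ (-(N : ℝ) / 2) * Real.exp (-‖x‖ ^ 2 / (4 * τ))

/-- The heat semigroup `e^{τΔ}`. -/
def heat (τ : ℝ) (u : Spc N → F) : Spc N → F :=
  if τ ≤ 0 then u else fun x => ∫ y, heatKer N τ (x - y) • u y

/-- The heat semigroup composed with a spatial derivative, `e^{τΔ}∂_j`
(the derivative acting on the Gaussian kernel). -/
def heatD (τ : ℝ) (j : Fin N) (u : Spc N → F) : Spc N → F :=
  if τ ≤ 0 then 0 else fun x => ∫ y, fderiv ℝ (heatKer N τ) (x - y) (e N j) • u y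

/-- Complexification followed by the Fourier transform. -/
def fC (f : Spc N → ℝ) : Spc N → ℂ := 𝓕 fun x => (f x : ℂ)

/-- The Leray projector `𝒫 = Id - ∇Δ⁻¹ div`, as the Fourier multiplier with (matrix) symbol
`δ_{jk} - ξ_jξ_k/|ξ|²`. -/
def leray (u : Spc N → Spc N) : Spc N → Spc N :=
  fun x => (WithLp.equiv 2 (Fin N → ℝ)).symm fun j =>
    (𝓕⁻ (fun ξ : Spc N =>
        ∑ k, (((if j = k then (1:ℝ) else 0) - ξ j * ξ k / ‖ξ‖ ^ 2 : ℝ) : ℂ)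
          * fC (fun y => u y k) ξ) x).re

/-- Weak (distributional) solution of the Boussinesq system on `(0,T) × ℝ^N`
with initial data `(θ₀, u₀)`:
`∂ₜθ + div (θ u) = 0`, `∂ₜu + div(u ⊗ u) - ν Δu + ∇Π = θ e_N`, `div u = 0`. -/
def IsBoussinesqOn (N : ℕ) (hN : 0 < N) (ν T : ℝ)
    (θ₀ : Spc N → ℝ) (u₀ : Spc N → Spc N)
    (θ : ℝ → Spc N → ℝ) (u : ℝ → Spc N → Spc N) (Pr : ℝ → Spc N → ℝ) : Prop :=
  (∀ ψ : ℝ × Spc N → ℝ, Test ψ → VanishAfter T ψ →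
    (∫ t in Ioc (0:ℝ) T, ∫ x,
        (θ t x * dt ψ (t, x) + θ t x * ∑ i, u t x i * dx i ψ (t, x)))
      + ∫ x, θ₀ x * ψ (0, x) = 0) ∧
  (∀ w : ℝ × Spc N → Spc N, Test w → VanishAfter T w →
    (∫ t in Ioc (0:ℝ) T, ∫ x,
        ((∑ j, u t x j * dt w (t, x) j)
          + (∑ i, ∑ j, u t x i * u t x j * dx i w (t, x) j)
          + ν * (∑ j, u t x j * lap w (t, x) j)
          + Pr t x * (∑ i, dx i w (t, x) i)
          + θ t x * w (t, x) (lastIdx N hN)))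
      + ∫ x, ∑ j, u₀ x j * w (0, x) j = 0) ∧
  (∀ t ∈ Ioc (0:ℝ) T, WeakDivFree (u t))

/-- Weak solution of the transport equation `∂ₜθ + div(θ u) = f`, `θ(0) = θ₀`, on `(0,T)`,
for a divergence-free `u`. -/
def IsTransportOn (N : ℕ) (T : ℝ) (u : ℝ → Spc N → Spc N)
    (f : ℝ → Spc N → ℝ) (θ₀ : Spc N → ℝ) (θ : ℝ → Spc N → ℝ) : Prop :=
  ∀ ψ : ℝ × Spc N → ℝ, Test ψ → VanishAfter T ψ →
    (∫ t in Ioc (0:ℝ) T, ∫ x,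
        (θ t x * dt ψ (t, x) + θ t x * ∑ i, u t x i * dx i ψ (t, x) + f t x * ψ (t, x)))
      + ∫ x, θ₀ x * ψ (0, x) = 0

/-- Weak solution of the transport-diffusion equation
`∂ₜρ + div(ρ u) - ν Δρ = f`, `ρ(0) = ρ₀`, on `(0,T)`. -/
def IsTDiffOn (N : ℕ) (ν T : ℝ) (u : ℝ → Spc N → Spc N)
    (f : ℝ → Spc N → ℝ) (ρ₀ : Spc N → ℝ) (ρ : ℝ → Spc N → ℝ) : Prop :=
  ∀ ψ : ℝ × Spc N → ℝ, Test ψ → VanishAfter T ψ →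
    (∫ t in Ioc (0:ℝ) T, ∫ x,
        (ρ t x * dt ψ (t, x) + ρ t x * ∑ i, u t x i * dx i ψ (t, x)
          + ν * ρ t x * lap ψ (t, x) + f t x * ψ (t, x)))
      + ∫ x, ρ₀ x * ψ (0, x) = 0

/-- Weak solution of the heat equation `∂ₜu - ν Δu = f`, `u(0) = u₀`, on `(0,T)`. -/
def IsHeatOn (N : ℕ) (ν T : ℝ) (f : ℝ → Spc N → F) (u₀ : Spc N → F)
    (u : ℝ → Spc N → F) : Prop :=
  ∀ ψ : ℝ × Spc N → ℝ, Test ψ → VanishAfter T ψ →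
    (∫ t in Ioc (0:ℝ) T, ∫ x,
        (dt ψ (t, x) • u t x + (ν * lap ψ (t, x)) • u t x + ψ (t, x) • f t x))
      + ∫ x, ψ (0, x) • u₀ x = 0

/-- Weak solution of the Navier–Stokes system
`∂ₜu + div(u ⊗ u) - ν Δu + ∇Π = f`, `div u = 0`, `u(0) = u₀`, on `(0,T)`. -/
def IsNSOn (N : ℕ) (ν T : ℝ) (u₀ : Spc N → Spc N) (f : ℝ → Spc N → Spc N)
    (u : ℝ → Spc N → Spc N) (Pr : ℝ → Spc N → ℝ) : Prop :=
  (∀ w : ℝ × Spc N → Spc N, Test w → VanishAfter T w →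
    (∫ t in Ioc (0:ℝ) T, ∫ x,
        ((∑ j, u t x j * dt w (t, x) j)
          + (∑ i, ∑ j, u t x i * u t x j * dx i w (t, x) j)
          + ν * (∑ j, u t x j * lap w (t, x) j)
          + Pr t x * (∑ i, dx i w (t, x) i)
          + ∑ j, f t x j * w (t, x) j))
      + ∫ x, ∑ j, u₀ x j * w (0, x) j = 0) ∧
  (∀ t ∈ Ioc (0:ℝ) T, WeakDivFree (u t))

/-- `u : [0,T] → X` is bounded and continuous into the (quasi-normed) function space with
(quasi-)norm `X`. -/
def ContInto (T : ℝ) (X : (Spc N → F) → ℝ≥0∞) (u : ℝ → Spc N → F) : Prop :=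
  (∀ t ∈ Icc (0:ℝ) T, X (u t) ≠ ∞) ∧
  ∀ t₀ ∈ Icc (0:ℝ) T,
    Tendsto (fun t => X (fun x => u t x - u t₀ x)) (nhdsWithin t₀ (Icc 0 T)) (nhds 0)


/-- Countable triangle inequality for the `L^q` norm of nonnegative functions. -/
theorem eLpNorm_tsum_le {α : Type*} [MeasurableSpace α] {μ : Measure α} {q : ℝ≥0∞} (hq : 1 ≤ q)
    {f : ℕ → α → ℝ≥0∞} (hf : ∀ n, Measurable (f n)) :
    eLpNorm (fun x => ∑' n, f n x) q μ ≤ ∑' n, eLpNorm (f n) q μ := by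
  have hq0 : q ≠ 0 := (zero_lt_one.trans_le hq).ne'
  obtain rfl | hqt := eq_or_ne q ∞
  · simp only [eLpNorm_exponent_top]
    refine essSup_le_of_ae_le _ ?_
    have h : ∀ᵐ x ∂μ, ∀ n, ‖f n x‖ₑ ≤ eLpNormEssSup (f n) μ :=
      ae_all_iff.2 fun n => enorm_ae_le_eLpNormEssSup (f n) μ
    filter_upwards [h] with x hx
    simpa using ENNReal.tsum_le_tsum hx
  have hpos : 0 < q.toReal := ENNReal.toReal_pos hq0 hqt
  have hmono : Monotone fun n x => (∑ i ∈ Finset.range n, f i x) ^ q.toReal := by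
    intro m n hmn x
    exact ENNReal.rpow_le_rpow (Finset.sum_le_sum_of_subset (Finset.range_mono hmn)) hpos.le
  rw [eLpNorm_eq_lintegral_rpow_enorm_toReal hq0 hqt, one_div, ENNReal.rpow_inv_le_iff hpos]
  have hsup : ∀ x, ‖∑' n, f n x‖ₑ ^ q.toReal
      = ⨆ n, (∑ i ∈ Finset.range n, f i x) ^ q.toReal := by
    intro x
    rw [enorm_eq_self, ENNReal.tsum_eq_iSup_nat]
    exact (ENNReal.orderIsoRpow q.toReal hpos).map_iSup _
  simp_rw [hsup]
  rw [lintegral_iSup (fun n => (Finset.measurable_fun_sum _ fun i _ => hf i).pow_const _) hmono]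
  refine iSup_le fun n => ?_
  rw [← ENNReal.rpow_inv_le_iff hpos]
  have h1 := eLpNorm_sum_le (μ := μ) (s := Finset.range n) (f := f)
    (fun i _ => (hf i).aestronglyMeasurable) hq
  rw [eLpNorm_eq_lintegral_rpow_enorm_toReal hq0 hqt, one_div] at h1
  simp only [Finset.sum_apply, enorm_eq_self] at h1
  exact h1.trans (ENNReal.sum_le_tsum _)

/-- Young's inequality `‖a * b‖_q ≤ ‖a‖_1 ‖b‖_q` for nonnegative functions. -/
theorem eLpNorm_lconv_le {q : ℝ≥0∞} (hq : 1 ≤ q) {a b : Spc N → ℝ≥0∞}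
    (ha : Measurable a) (hb : Measurable b) :
    eLpNorm (fun x => ∫⁻ y, a (x - y) * b y) q volume
      ≤ (∫⁻ x, a x) * eLpNorm b q volume := by
  have hq0 : q ≠ 0 := (zero_lt_one.trans_le hq).ne'
  have hI : ∀ x, ∫⁻ y, a (x - y) = ∫⁻ y, a y := fun x => lintegral_sub_left_eq_self a x
  have ha' : ∀ x, Measurable fun y => a (x - y) := fun x => by fun_prop
  obtain rfl | hqt := eq_or_ne q ∞
  · simp only [eLpNorm_exponent_top]
    refine essSup_le_of_ae_le _ (Eventually.of_forall fun x => ?_)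
    calc ‖∫⁻ y, a (x - y) * b y‖ₑ = ∫⁻ y, a (x - y) * b y := enorm_eq_self _
      _ ≤ ∫⁻ y, a (x - y) * eLpNormEssSup b volume := by
        refine lintegral_mono_ae ?_
        filter_upwards [enorm_ae_le_eLpNormEssSup b volume] with y hy
        exact mul_le_mul_right hy _
      _ = (∫⁻ x, a x) * eLpNormEssSup b volume := by
        rw [lintegral_mul_const _ (ha' x), hI]
  set r := q.toReal with hr
  have hpos : 0 < r := ENNReal.toReal_pos hq0 hqt
  have hr1 : 1 ≤ r := by
    simpa using ENNReal.toReal_mono hqt hq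
  have hinv : r⁻¹ ≤ 1 := inv_le_one_of_one_le₀ hr1
  have hrr : r⁻¹ * r = 1 := inv_mul_cancel₀ hpos.ne'
  rw [eLpNorm_eq_lintegral_rpow_enorm_toReal hq0 hqt, one_div, ENNReal.rpow_inv_le_iff hpos,
    eLpNorm_eq_lintegral_rpow_enorm_toReal hq0 hqt, one_div, ← hr,
    ENNReal.mul_rpow_of_nonneg _ _ hpos.le, ← ENNReal.rpow_mul _ r⁻¹, hrr, ENNReal.rpow_one]
  simp only [enorm_eq_self]
  have hpt : ∀ x, (∫⁻ y, a (x - y) * b y) ^ r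
      ≤ (∫⁻ y, a y) ^ (r - 1) * ∫⁻ y, a (x - y) * b y ^ r := by
    intro x
    have h := ENNReal.lintegral_mul_norm_pow_le (μ := volume) (ha' x).aemeasurable
      ((ha' x).mul (hb.pow_const r)).aemeasurable (sub_nonneg.2 hinv)
      (inv_nonneg.2 hpos.le) (sub_add_cancel 1 r⁻¹)
    have heq : ∀ y, a (x - y) ^ (1 - r⁻¹) * (a (x - y) * b y ^ r) ^ r⁻¹ = a (x - y) * b y := by
      intro y
      rw [ENNReal.mul_rpow_of_nonneg _ _ (inv_nonneg.2 hpos.le), ← mul_assoc,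
        ← ENNReal.rpow_add_of_nonneg _ _ (sub_nonneg.2 hinv) (inv_nonneg.2 hpos.le),
        sub_add_cancel, ENNReal.rpow_one, ← ENNReal.rpow_mul, mul_comm r, hrr, ENNReal.rpow_one]
    simp only [Pi.mul_apply, heq, hI] at h
    refine (ENNReal.rpow_le_rpow h hpos.le).trans_eq ?_
    rw [ENNReal.mul_rpow_of_nonneg _ _ hpos.le, ← ENNReal.rpow_mul, ← ENNReal.rpow_mul, hrr,
      ENNReal.rpow_one, sub_mul, hrr, one_mul]
  have hmeas : Measurable fun z : Spc N × Spc N => a (z.1 - z.2) * b z.2 ^ r := by fun_prop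
  calc ∫⁻ x, (∫⁻ y, a (x - y) * b y) ^ r
      ≤ ∫⁻ x, (∫⁻ y, a y) ^ (r - 1) * ∫⁻ y, a (x - y) * b y ^ r := lintegral_mono hpt
    _ = (∫⁻ y, a y) ^ (r - 1) * ∫⁻ x, ∫⁻ y, a (x - y) * b y ^ r :=
        lintegral_const_mul _ hmeas.lintegral_prod_right'
    _ = (∫⁻ y, a y) ^ (r - 1) * ((∫⁻ x, a x) * ∫⁻ y, b y ^ r) := by
        rw [lintegral_lintegral_swap hmeas.aemeasurable]
        congr 1
        rw [← lintegral_const_mul _ (hb.pow_const r)]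
        refine lintegral_congr fun y => ?_
        rw [lintegral_mul_const _ (by fun_prop), lintegral_sub_right_eq_self a y]
    _ = (∫⁻ y, a y) ^ r * ∫⁻ y, b y ^ r := by
        rw [← mul_assoc]
        congr 1
        nth_rewrite 2 [← ENNReal.rpow_one (∫⁻ x, a x)]
        rw [← ENNReal.rpow_add_of_nonneg _ _ (by linarith) zero_le_one, sub_add_cancel]

theorem lconv_comm (a b : Spc N → ℝ≥0∞) (x : Spc N) :
    ∫⁻ y, a (x - y) * b y = ∫⁻ y, b (x - y) * a y := by
  rw [← lintegral_sub_left_eq_self _ x]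
  simp [mul_comm]

theorem eLpNorm_comp_smul {f : Spc N → ℝ} (hf : Measurable f) {c : ℝ} (hc : 0 < c) (q : ℝ≥0∞) :
    eLpNorm (fun x => f (c • x)) q volume
      = ENNReal.ofReal (c ^ (-((N : ℝ) / q.toReal))) * eLpNorm f q volume := by
  have h1 : Measurable fun x : Spc N => c • x := by fun_prop
  have h := eLpNorm_map_measure (μ := (volume : Measure (Spc N))) (p := q) (f := fun x => c • x)
    hf.aestronglyMeasurable h1.aemeasurable
  change _ = eLpNorm (fun x => f (c • x)) q volume at h
  have hcN : 0 < (c ^ N)⁻¹ := by positivity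
  rw [← h, Measure.map_addHaar_smul _ hc.ne', finrank_euclideanSpace_fin, abs_of_pos hcN,
    eLpNorm_smul_measure_of_ne_zero (by simpa using hcN), smul_eq_mul,
    ENNReal.ofReal_rpow_of_pos hcN]
  congr 2
  rw [Real.rpow_neg hc.le, Real.inv_rpow (by positivity), ← Real.rpow_natCast, ← Real.rpow_mul hc.le]
  simp [div_eq_mul_inv]

theorem invKer_comp_inv_smul (g : Spc N → ℝ) {c : ℝ} (hc : 0 < c) (x : Spc N) :
    invKer (fun ξ => g (c⁻¹ • ξ)) x = c ^ N * invKer g (c • x) := by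
  have h := Measure.integral_comp_inv_smul_of_nonneg (volume : Measure (Spc N))
    (fun ξ => Complex.exp (↑(2 * π * inner ℝ ξ (c • x)) * Complex.I) • (g ξ : ℂ)) hc.le
  simp only [invKer, Real.fourierInv_eq']
  have h2 : ∀ ξ : Spc N, inner ℝ (c⁻¹ • ξ) (c • x) = inner ℝ ξ x := by
    intro ξ
    rw [real_inner_smul_left, real_inner_smul_right, inv_mul_cancel_left₀ hc.ne']
  simp only [h2, finrank_euclideanSpace_fin] at h
  rw [h, Complex.smul_re, smul_eq_mul]

theorem memLp_invKer {g : Spc N → ℝ} (hg : ContDiff ℝ (⊤ : ℕ∞) g) (hs : HasCompactSupport g)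
    (q : ℝ≥0∞) : MemLp (invKer g) q volume := by
  have hs' : HasCompactSupport fun ξ => (g ξ : ℂ) := hs.comp_left (g := fun t : ℝ => (t : ℂ)) rfl
  have hg' : ContDiff ℝ (⊤ : ℕ∞) fun ξ => (g ξ : ℂ) := Complex.ofRealCLM.contDiff.comp hg
  have h := ((𝓕⁻ (hs'.toSchwartzMap hg')).memLp q volume).re
  rw [SchwartzMap.fourierInv_coe] at h
  exact h

theorem continuous_invKer {g : Spc N → ℝ} (hg : ContDiff ℝ (⊤ : ℕ∞) g) (hs : HasCompactSupport g) :
    Continuous (invKer g) := by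
  have hs' : HasCompactSupport fun ξ => (g ξ : ℂ) := hs.comp_left (g := fun t : ℝ => (t : ℂ)) rfl
  have hg' : ContDiff ℝ (⊤ : ℕ∞) fun ξ => (g ξ : ℂ) := Complex.ofRealCLM.contDiff.comp hg
  have h := Complex.continuous_re.comp (𝓕⁻ (hs'.toSchwartzMap hg')).continuous
  rw [SchwartzMap.fourierInv_coe] at h
  exact h

theorem IsLPData.contDiff_phi {χ φ : Spc N → ℝ} (h : IsLPData N χ φ) :
    ContDiff ℝ (⊤ : ℕ∞) φ := by
  rw [funext h.phiDef]
  exact (h.smooth.comp (contDiff_id.const_smul _)).sub h.smooth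

theorem IsLPData.hasCompactSupport_phi {χ φ : Spc N → ℝ} (h : IsLPData N χ φ) :
    HasCompactSupport φ := by
  refine HasCompactSupport.intro (isCompact_closedBall (0 : Spc N) (8 / 3)) fun ξ hξ => ?_
  rw [mem_closedBall_zero_iff, not_le] at hξ
  rw [h.phiDef, h.suppPt, h.suppPt ξ (by linarith), sub_zero]
  rw [norm_smul, norm_inv, Real.norm_ofNat]
  linarith

theorem volume_lt_norm_le_of_wLp {p : ℝ} (hp : 0 < p) {u : Spc N → ℝ} {w : ℝ} (hw : 0 < w)
    (hu : wLp p u = ENNReal.ofReal w) {c : ℝ} (hc : 0 < c) :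
    volume {x | w * c < ‖u x‖} ≤ ENNReal.ofReal (c ^ (-p)) := by
  have hwc : 0 < w * c := mul_pos hw hc
  have h : ENNReal.ofReal (w * c) * volume {x | w * c < ‖u x‖} ^ (1 / p) ≤ ENNReal.ofReal w := by
    rw [← hu]
    exact le_iSup₂_of_le (f := fun (lam : ℝ) (_ : lam ∈ Ioi (0 : ℝ)) =>
      ENNReal.ofReal lam * volume {x | lam < ‖u x‖} ^ (1 / p)) (w * c) hwc le_rfl
  rw [mul_comm, ← ENNReal.le_div_iff_mul_le (Or.inl (by simpa using hwc))
    (Or.inl ENNReal.ofReal_ne_top), ← ENNReal.ofReal_div_of_pos hwc, one_div,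
    ENNReal.rpow_inv_le_iff hp] at h
  refine h.trans_eq ?_
  rw [div_mul_cancel_left₀ hw.ne', ENNReal.ofReal_rpow_of_pos (inv_pos.2 hc),
    Real.inv_rpow hc.le, Real.rpow_neg hc.le]

/-- A measurable majorant of the part of a weak `L^p` function whose values lie in the dyadic
shells `(w b ρ^k, 2 w b ρ^k]`, `k ∈ ℕ`, together with a bound for its `L^s` norm. -/
theorem exists_dyadic_majorant {p : ℝ} (hp : 0 < p) {u : Spc N → ℝ} {w : ℝ} (hw : 0 < w)
    (hu : wLp p u = ENNReal.ofReal w) {s : ℝ≥0∞} (hs : 1 ≤ s) {b ρ : ℝ} (hb : 0 < b) (hρ : 0 < ρ)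
    (hρ1 : ρ ^ (1 - p / s.toReal) < 1) :
    ∃ f : Spc N → ℝ≥0∞, Measurable f ∧
      (∀ y, ∀ k : ℕ, w * (b * ρ ^ k) < ‖u y‖ → ‖u y‖ ≤ 2 * (w * (b * ρ ^ k)) → ‖u y‖ₑ ≤ f y) ∧
      eLpNorm f s volume
        ≤ ENNReal.ofReal (2 * w * b ^ (1 - p / s.toReal) * (1 - ρ ^ (1 - p / s.toReal))⁻¹) := by
  set γ := 1 - p / s.toReal with hγ
  have hc : ∀ k : ℕ, 0 < b * ρ ^ k := fun k => by positivity
  let T : ℕ → Set (Spc N) := fun k => toMeasurable volume {x | w * (b * ρ ^ k) < ‖u x‖}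
  let F : ℕ → Spc N → ℝ≥0∞ := fun k =>
    (T k).indicator fun _ => ENNReal.ofReal (2 * (w * (b * ρ ^ k)))
  have hF : ∀ k, Measurable (F k) := fun k =>
    measurable_const.indicator (measurableSet_toMeasurable _ _)
  have hFs : ∀ k, eLpNorm (F k) s volume ≤ ENNReal.ofReal (2 * w * b ^ γ * (ρ ^ γ) ^ k) := by
    intro k
    refine (eLpNorm_indicator_const_le _ _).trans ?_
    have hT : volume (T k) ≤ ENNReal.ofReal ((b * ρ ^ k) ^ (-p)) := by
      rw [measure_toMeasurable]
      exact volume_lt_norm_le_of_wLp hp hw hu (hc k)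
    rw [enorm_eq_self]
    grw [hT]
    rw [ENNReal.ofReal_rpow_of_pos (Real.rpow_pos_of_pos (hc k) _), ← Real.rpow_mul (hc k).le,
      ← ENNReal.ofReal_mul (by have := hc k; positivity)]
    refine (congrArg ENNReal.ofReal ?_).le
    have h1 : (b * ρ ^ k) * (b * ρ ^ k) ^ (-p * (1 / s.toReal)) = b ^ γ * (ρ ^ γ) ^ k := by
      rw [← Real.rpow_natCast (ρ ^ γ), ← Real.rpow_mul hρ.le, mul_comm γ, Real.rpow_mul hρ.le,
        Real.rpow_natCast, ← Real.mul_rpow hb.le (by positivity), hγ, sub_eq_add_neg,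
        Real.rpow_add (hc k), Real.rpow_one]
      congr 2
      ring
    linear_combination (2 * w) * h1
  refine ⟨fun x => ∑' k, F k x, Measurable.tsum hF, fun y k hk hk' => ?_, ?_⟩
  · refine le_trans ?_ (ENNReal.le_tsum k)
    have hy : y ∈ T k := subset_toMeasurable _ _ hk
    simp only [F, indicator_of_mem hy]
    rw [← ofReal_norm]
    exact ENNReal.ofReal_le_ofReal hk'
  · refine (eLpNorm_tsum_le hs hF).trans ((ENNReal.tsum_le_tsum hFs).trans_eq ?_)
    have h0 : 0 ≤ ρ ^ γ := Real.rpow_nonneg hρ.le _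
    rw [← ENNReal.ofReal_tsum_of_nonneg (fun k => by positivity)
      ((summable_geometric_of_lt_one h0 hρ1).mul_left _), tsum_mul_left,
      tsum_geometric_of_lt_one h0 hρ1]

theorem eLpNorm_hBlock_kernel {φ : Spc N → ℝ} (hφ : Measurable (invKer φ)) (j : ℤ) (s : ℝ≥0∞) :
    eLpNorm (invKer fun ξ => φ ((2 : ℝ) ^ (-j) • ξ)) s volume
      = ENNReal.ofReal (((2 : ℝ) ^ j) ^ ((N : ℝ) - N / s.toReal)) * eLpNorm (invKer φ) s volume := by
  have hc : (0 : ℝ) < 2 ^ j := by positivity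
  have h : (invKer fun ξ => φ ((2 : ℝ) ^ (-j) • ξ))
      = (((2 : ℝ) ^ j) ^ N) • fun x => invKer φ ((2 : ℝ) ^ j • x) := by
    funext x
    rw [zpow_neg, invKer_comp_inv_smul φ hc]
    rfl
  rw [h, eLpNorm_const_smul, eLpNorm_comp_smul hφ hc, ← mul_assoc,
    Real.enorm_of_nonneg (by positivity), ← ENNReal.ofReal_mul (by positivity), sub_eq_add_neg,
    Real.rpow_add hc, Real.rpow_natCast]

theorem eLpNorm_hBlock_le {φ : Spc N → ℝ} {j : ℤ} {u : Spc N → ℝ} {q : ℝ≥0∞} (hq : 1 ≤ q)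
    (hK : Measurable (invKer fun ξ => φ ((2 : ℝ) ^ (-j) • ξ))) {f g : Spc N → ℝ≥0∞}
    (hf : Measurable f) (hg : Measurable g) (hu : ∀ y, ‖u y‖ₑ ≤ f y + g y) :
    eLpNorm (hBlock φ j u) q volume
      ≤ eLpNorm (invKer fun ξ => φ ((2 : ℝ) ^ (-j) • ξ)) q volume * eLpNorm f 1 volume
        + eLpNorm (invKer fun ξ => φ ((2 : ℝ) ^ (-j) • ξ)) 1 volume * eLpNorm g q volume := by
  set K := invKer fun ξ => φ ((2 : ℝ) ^ (-j) • ξ)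
  let k : Spc N → ℝ≥0∞ := fun x => ‖K x‖ₑ
  have hk : Measurable k := hK.enorm
  have hpt : ∀ x, ‖hBlock φ j u x‖ₑ
      ≤ ‖(∫⁻ y, f (x - y) * k y) + ∫⁻ y, k (x - y) * g y‖ₑ := by
    intro x
    have hkf : Measurable fun y => k (x - y) * f y := by fun_prop
    rw [enorm_eq_self, lconv_comm f k, ← lintegral_add_left hkf]
    refine (enorm_integral_le_lintegral_enorm _).trans (lintegral_mono fun y => ?_)
    rw [enorm_smul, ← mul_add]
    exact mul_le_mul_right (hu y) _
  have hmeas : ∀ {a b : Spc N → ℝ≥0∞}, Measurable a → Measurable b →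
      AEStronglyMeasurable (fun x => ∫⁻ y, a (x - y) * b y) volume := by
    intro a b ha hb
    have h : Measurable fun z : Spc N × Spc N => a (z.1 - z.2) * b z.2 := by fun_prop
    exact h.lintegral_prod_right'.aestronglyMeasurable
  refine (eLpNorm_mono_enorm hpt).trans
    ((eLpNorm_add_le (hmeas hf hk) (hmeas hk hg) hq).trans (add_le_add ?_ ?_))
  · refine (eLpNorm_lconv_le hq hf hk).trans_eq ?_
    rw [mul_comm, eLpNorm_one_eq_lintegral_enorm (f := f)]
    exact congrArg₂ _ (eLpNorm_enorm K) rfl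
  · refine (eLpNorm_lconv_le hq hk hg).trans_eq ?_
    rw [eLpNorm_one_eq_lintegral_enorm]

theorem hBlock_eq_zero_of_wLp_eq_zero {p : ℝ} (hp : 0 < p) {u : Spc N → ℝ} (hu : wLp p u = 0)
    (φ : Spc N → ℝ) (j : ℤ) : hBlock φ j u = 0 := by
  have h0 : ∀ n : ℕ, volume {x | 1 / ((n : ℝ) + 1) < ‖u x‖} = 0 := by
    intro n
    have hn : (0 : ℝ) < 1 / ((n : ℝ) + 1) := by positivity
    simp only [wLp, ENNReal.iSup_eq_zero] at hu
    have h := hu _ hn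
    rw [mul_eq_zero, ENNReal.rpow_eq_zero_iff_of_pos (by positivity)] at h
    exact h.resolve_left (by simpa using hn)
  have hae : ∀ᵐ x, u x = 0 := by
    have h : ∀ᵐ x, ∀ n : ℕ, ¬ 1 / ((n : ℝ) + 1) < ‖u x‖ :=
      ae_all_iff.2 fun n => by simpa [ae_iff] using h0 n
    filter_upwards [h] with x hx
    by_contra hne
    obtain ⟨n, hn⟩ := exists_nat_one_div_lt (norm_pos_iff.2 hne)
    exact hx n hn
  funext x
  refine integral_eq_zero_of_ae ?_
  filter_upwards [hae] with y hy
  simp [hy]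

/-- Every positive real lies in a dyadic shell `(a 2^n, a 2^{n+1}]`, of nonnegative or negative
index. -/
theorem exists_dyadic_shell {a t : ℝ} (ha : 0 < a) (ht : 0 < t) :
    (∃ k : ℕ, a * 2 ^ k < t ∧ t ≤ 2 * (a * 2 ^ k)) ∨
      ∃ k : ℕ, a * (1 / 2 * (1 / 2) ^ k) < t ∧ t ≤ 2 * (a * (1 / 2 * (1 / 2) ^ k)) := by
  obtain ⟨n, h1, h2⟩ := exists_mem_Ioc_zpow (div_pos ht ha) (one_lt_two (α := ℝ))
  rw [lt_div_iff₀ ha] at h1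
  rw [div_le_iff₀ ha, zpow_add_one₀ two_ne_zero] at h2
  obtain ⟨k, rfl | rfl⟩ : ∃ k : ℕ, n = k ∨ n = -(k + 1 : ℕ) := by
    obtain h | h := le_or_gt 0 n
    · exact ⟨n.toNat, Or.inl (by omega)⟩
    · exact ⟨(-n - 1).toNat, Or.inr (by omega)⟩
  · refine Or.inl ⟨k, ?_, ?_⟩ <;> rw [zpow_natCast] at * <;> linarith
  · have h : (2 : ℝ) ^ (-((k + 1 : ℕ) : ℤ)) = 1 / 2 * (1 / 2) ^ k := by
      rw [zpow_neg, zpow_natCast, ← inv_pow, pow_succ']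
      norm_num
    rw [h] at h1 h2
    exact Or.inr ⟨k, by linarith, by linarith⟩

/-- embedding of weak Lebesgue spaces into homogeneous Besov spaces.
For `1 < p < q ≤ ∞`, `L^{p,∞}(ℝ^N) ↪ Ḃ^{N/q - N/p}_{q,∞}(ℝ^N)`:
`sup_{j∈ℤ} 2^{j(N/q - N/p)} ‖Δ̇_j u‖_{L^q} ≤ C ‖u‖_{L^{p,∞}}`. -/
theorem weakLp_embeds_besov
    (N : ℕ) (hN : 0 < N) (χ φ : Spc N → ℝ) (hLP : IsLPData N χ φ)
    (p : ℝ) (q : ℝ≥0∞) (hp : 1 < p) (hpq : ENNReal.ofReal p < q) :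
    ∃ C : ℝ, 0 < C ∧
      ∀ u : Spc N → ℝ,
        (⨆ j : ℤ, (2 : ℝ≥0∞) ^ ((j : ℝ) * ((N:ℝ)/q.toReal - (N:ℝ)/p))
            * eLpNorm (hBlock φ j u) q volume)
          ≤ ENNReal.ofReal C * wLp p u := by
  have hp0 : 0 < p := zero_lt_one.trans hp
  have hq1 : 1 ≤ q := by
    refine le_trans ?_ hpq.le
    simpa using ENNReal.ofReal_le_ofReal hp.le
  have hδ : 0 < 1 - p / q.toReal := by
    obtain rfl | hqt := eq_or_ne q ∞
    · simp
    · have hlt : p < q.toReal := (ENNReal.ofReal_lt_iff_lt_toReal hp0.le hqt).1 hpq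
      rw [sub_pos, div_lt_one (hp0.trans hlt)]
      exact hlt
  have hKm : ∀ s, MemLp (invKer φ) s volume :=
    memLp_invKer hLP.contDiff_phi hLP.hasCompactSupport_phi
  have hKc : Continuous (invKer φ) :=
    continuous_invKer hLP.contDiff_phi hLP.hasCompactSupport_phi
  set δ := 1 - p / q.toReal with hδdef
  set Mq := (eLpNorm (invKer φ) q volume).toReal
  set M1 := (eLpNorm (invKer φ) 1 volume).toReal
  have hMq' : eLpNorm (invKer φ) q volume = ENNReal.ofReal Mq :=
    (ENNReal.ofReal_toReal (hKm q).eLpNorm_ne_top).symm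
  have hM1' : eLpNorm (invKer φ) 1 volume = ENNReal.ofReal M1 :=
    (ENNReal.ofReal_toReal (hKm 1).eLpNorm_ne_top).symm
  have hMq0 : 0 ≤ Mq := ENNReal.toReal_nonneg
  have hM10 : 0 ≤ M1 := ENNReal.toReal_nonneg
  have hρ1 : (2 : ℝ) ^ (1 - p) < 1 := Real.rpow_lt_one_of_one_lt_of_neg one_lt_two (by linarith)
  have hρ2 : (1 / 2 : ℝ) ^ δ < 1 := Real.rpow_lt_one (by norm_num) (by norm_num) hδ
  set c1 := (1 - (2 : ℝ) ^ (1 - p))⁻¹ with hc1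
  set c2 := (1 / 2 : ℝ) ^ δ * (1 - (1 / 2 : ℝ) ^ δ)⁻¹ with hc2
  have hc10 : 0 < c1 := inv_pos.2 (sub_pos.2 hρ1)
  have hc20 : 0 < c2 := mul_pos (by positivity) (inv_pos.2 (sub_pos.2 hρ2))
  refine ⟨2 * c1 * Mq + 2 * c2 * M1 + 1, by positivity, fun u => iSup_le fun j => ?_⟩
  obtain h0 | h0 := eq_or_ne (wLp p u) 0
  · simp [hBlock_eq_zero_of_wLp_eq_zero hp0 h0]
  obtain htop | htop := eq_or_ne (wLp p u) ∞
  · rw [htop, ENNReal.mul_top (by simpa using (by positivity : _))]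
    exact le_top
  set w := (wLp p u).toReal
  have hw : 0 < w := ENNReal.toReal_pos h0 htop
  have hu : wLp p u = ENNReal.ofReal w := (ENNReal.ofReal_toReal htop).symm
  set D : ℝ := (2 : ℝ) ^ j with hD
  have hD0 : 0 < D := by positivity
  set B : ℝ := D ^ ((N : ℝ) / p) with hB
  have hB0 : 0 < B := by positivity
  obtain ⟨f, hf, hfu, hfn⟩ := exists_dyadic_majorant hp0 hw hu (s := 1) le_rfl hB0
    (ρ := 2) two_pos (by simpa using hρ1)
  obtain ⟨g, hg, hgu, hgn⟩ := exists_dyadic_majorant hp0 hw hu (s := q) hq1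
    (b := B * (1 / 2)) (ρ := 1 / 2) (by positivity) (by norm_num) hρ2
  have hmaj : ∀ y, ‖u y‖ₑ ≤ f y + g y := by
    intro y
    obtain hy | hy := eq_or_ne (u y) 0
    · simp [hy]
    obtain ⟨k, h1, h2⟩ | ⟨k, h1, h2⟩ := exists_dyadic_shell (mul_pos hw hB0) (norm_pos_iff.2 hy)
    · rw [mul_assoc] at h1 h2
      exact (hfu y k h1 h2).trans le_self_add
    · refine (hgu y k ?_ ?_).trans le_add_self
      · linarith
      · linarith
  have hK : Measurable (invKer fun ξ => φ ((2 : ℝ) ^ (-j) • ξ)) := by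
    have h : (invKer fun ξ => φ ((2 : ℝ) ^ (-j) • ξ)) = fun x => D ^ N * invKer φ (D • x) := by
      funext x
      rw [zpow_neg, invKer_comp_inv_smul φ hD0]
    rw [h]
    exact (continuous_const.mul (hKc.comp (continuous_const_smul D))).measurable
  have hscale : (2 : ℝ≥0∞) ^ ((j : ℝ) * ((N : ℝ) / q.toReal - (N : ℝ) / p))
      = ENNReal.ofReal (D ^ ((N : ℝ) / q.toReal - (N : ℝ) / p)) := by
    rw [hD, ← Real.rpow_intCast, ← Real.rpow_mul two_pos.le, ← ENNReal.ofReal_rpow_of_pos two_pos,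
      ENNReal.ofReal_ofNat]
  grw [eLpNorm_hBlock_le hq1 hK hf hg hmaj, hfn, hgn]
  rw [eLpNorm_hBlock_kernel hKc.measurable, eLpNorm_hBlock_kernel hKc.measurable, hMq', hM1',
    hscale, hu, ← hD]
  simp only [ENNReal.toReal_one, div_one, sub_self, Real.rpow_zero, ENNReal.ofReal_one, one_mul]
  have hi2 : 0 < (1 - (1 / 2 : ℝ) ^ δ)⁻¹ := inv_pos.2 (sub_pos.2 hρ2)
  rw [← ENNReal.ofReal_mul (by positivity), ← ENNReal.ofReal_mul (by positivity),
    ← ENNReal.ofReal_mul (by positivity), ← ENNReal.ofReal_add (by positivity) (by positivity),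
    ← ENNReal.ofReal_mul (by positivity), ← ENNReal.ofReal_mul (by positivity)]
  refine ENNReal.ofReal_le_ofReal ?_
  have e1 : D ^ ((N : ℝ) / q.toReal - (N : ℝ) / p) * D ^ ((N : ℝ) - N / q.toReal) * B ^ (1 - p)
      = 1 := by
    rw [hB, ← Real.rpow_mul hD0.le, ← Real.rpow_add hD0, ← Real.rpow_add hD0]
    convert Real.rpow_zero D using 2
    field_simp
    ring
  have e2 : D ^ ((N : ℝ) / q.toReal - (N : ℝ) / p) * B ^ δ = 1 := by
    rw [hB, ← Real.rpow_mul hD0.le, ← Real.rpow_add hD0]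
    convert Real.rpow_zero D using 2
    rw [hδdef, mul_sub, mul_one, div_mul_div_cancel₀ hp0.ne']
    ring
  rw [Real.mul_rpow hB0.le (by norm_num)]
  calc _ = (D ^ ((N : ℝ) / q.toReal - (N : ℝ) / p) * D ^ ((N : ℝ) - N / q.toReal) * B ^ (1 - p))
          * (2 * c1 * Mq * w)
        + (D ^ ((N : ℝ) / q.toReal - (N : ℝ) / p) * B ^ δ) * (2 * c2 * M1 * w) := by
        rw [hc1, hc2]
        ring
    _ ≤ (2 * c1 * Mq + 2 * c2 * M1 + 1) * w := by
        rw [e1, e2]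
        linarith

end Paper
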